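/- arXiv:1712.03757 — 9 statements merged into one kernel-verified Lean document; each statement's English description precedes it below -/
import Mathlib

section
/- Suppose, in addition, that g_{ij}/g_{ih} ≥ g_{kj}/g_{kh} for every cell k ≠ i. Then γ_{hj} ≥ γ_{hh}, i.e., the user j with the stronger serving-cell gain can decode the signal of user h regardless of the inter-cell interference (Lemma 1, decoding-order condition). -/
/-- Lemma 1 (decoding-order condition): two UEs `j` and `h` in the same cluster of cell `i`,
with serving-cell gains `gij > gih > 0`, intra-cluster powers `pju, phu > 0`, noise `σsq > 0`.
`K` indexes the (finitely many) other cells `k ≠ i`, each with power `p k > 0`, load `ρ k ≥ 0`,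
and gains `gj k > 0` (towards UE `j`), `gh k > 0` (towards UE `h`).
If `gij / gih ≥ gj k / gh k` for all `k`, then `γ_{hj} ≥ γ_{hh}`. -/
theorem decoding_order_condition {K : Type*} [Fintype K]
    (gij gih pju phu σsq : ℝ) (p ρ gj gh : K → ℝ)
    (hgih : 0 < gih) (hg : gih < gij)
    (hpju : 0 < pju) (hphu : 0 < phu) (hσ : 0 < σsq)
    (hp : ∀ k, 0 < p k) (hρ : ∀ k, 0 ≤ ρ k)
    (hgj : ∀ k, 0 < gj k) (hgh : ∀ k, 0 < gh k)
    (hratio : ∀ k, gj k / gh k ≤ gij / gih) :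
    phu * gih / (pju * gih + (∑ k, p k * gh k * ρ k) + σsq) ≤
      phu * gij / (pju * gij + (∑ k, p k * gj k * ρ k) + σsq) := by
  have hij : 0 < gij := hgih.trans hg
  have hSh : 0 ≤ ∑ k, p k * gh k * ρ k :=
    Finset.sum_nonneg fun k _ => mul_nonneg (mul_pos (hp k) (hgh k)).le (hρ k)
  have hSj : 0 ≤ ∑ k, p k * gj k * ρ k :=
    Finset.sum_nonneg fun k _ => mul_nonneg (mul_pos (hp k) (hgj k)).le (hρ k)
  have key : gih * ∑ k, p k * gj k * ρ k ≤ gij * ∑ k, p k * gh k * ρ k := by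
    rw [Finset.mul_sum, Finset.mul_sum]
    refine Finset.sum_le_sum fun k _ => ?_
    have h1 := (div_le_div_iff₀ (hgh k) hgih).1 (hratio k)
    have h2 := mul_le_mul_of_nonneg_left h1 (mul_nonneg (hp k).le (hρ k))
    linarith
  have hn : gih * σsq ≤ gij * σsq := mul_le_mul_of_nonneg_right hg.le hσ.le
  have hdh : 0 < pju * gih := mul_pos hpju hgih
  have hdj : 0 < pju * gij := mul_pos hpju hij
  rw [div_le_div_iff₀ (by linarith) (by linarith), mul_assoc, mul_assoc]
  refine mul_le_mul_of_nonneg_left ?_ hphu.le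
  linarith
end

section
/- For all real numbers S > 0, A ≥ 0, B ≥ 0, σ² > 0 and α > 1, one has α · log(1 + S/(A + αB + σ²)) > log(1 + S/(A + B + σ²)). (This is the scalability property of the per-RB capacity c(ρ) = M·B·log(1+γ(ρ)) used in the proof of Theorem 1: scaling all interfering loads by α > 1 decreases the capacity by strictly less than a factor α, i.e., 1/c(αρ) < α/c(ρ).) -/
/-- Scalability of the per-RB capacity (used in the proof of Theorem 1):
for signal power `S > 0`, intra-cell interference `A ≥ 0`, unit-load inter-cell
interference `B ≥ 0`, noise `σsq > 0` and load scale `α > 1`,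
`α · log(1 + S/(A + αB + σ²)) > log(1 + S/(A + B + σ²))`. -/
theorem capacity_scalability (S A B σsq α : ℝ)
    (hS : 0 < S) (hA : 0 ≤ A) (hB : 0 ≤ B) (hσ : 0 < σsq) (hα : 1 < α) :
    Real.log (1 + S / (A + B + σsq)) < α * Real.log (1 + S / (A + α * B + σsq)) := by
  have hαB : 0 ≤ α * B := mul_nonneg (by linarith) hB
  have h1 : 0 < A + B + σsq := by linarith
  have h2 : 0 < A + α * B + σsq := by linarith
  have hy : 0 < S / (A + α * B + σsq) := div_pos hS h2
  have hx : 0 < S / (A + B + σsq) := div_pos hS h1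
  have hle : S / (A + B + σsq) ≤ α * (S / (A + α * B + σsq)) := by
    rw [← mul_div_assoc, div_le_div_iff₀ h1 h2]
    have h3 : A + α * B + σsq ≤ α * (A + B + σsq) := by
      nlinarith [mul_nonneg (sub_nonneg.2 hα.le) (add_nonneg hA hσ.le)]
    nlinarith [mul_le_mul_of_nonneg_left h3 hS.le]
  have hb := one_add_mul_self_lt_rpow_one_add (s := S / (A + α * B + σsq))
    (by linarith) hy.ne' hα
  rw [← Real.log_rpow (by linarith)]
  exact Real.log_lt_log (by linarith) (by linarith)
end

section
/- Let α > 1, let the demands satisfy d_j > 0 for all j ∈ J, and let c and c' be capacity assignments with c_{ju} > 0 and c'_{ju} > c_{ju}/α for every pair with j ∈ u. Then V(c',d) < α · V(c,d) (the strict scalability step in the proof of Theorem 1: if the new capacities shrink by strictly less than a factor α, the minimum load grows by strictly less than a factor α). -/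
open Finset

/-- Feasible set `X(c,d)` of the single-cell load-minimization LP. -/
def FeasSet {U J : Type*} [Fintype U] (mem : J → U → Prop) [∀ j u, Decidable (mem j u)]
    (c : J → U → ℝ) (d : J → ℝ) : Set (U → ℝ) :=
  {x | (∀ u, 0 ≤ x u) ∧
    ∀ j, d j ≤ ∑ u ∈ Finset.univ.filter (fun u => mem j u), c j u * x u}

/-- Optimal value `V(c,d) = inf { Σ_u x_u : x ∈ X(c,d) }`. -/
noncomputable def optVal {U J : Type*} [Fintype U] (mem : J → U → Prop)
    [∀ j u, Decidable (mem j u)] (c : J → U → ℝ) (d : J → ℝ) : ℝ :=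
  sInf ((fun x : U → ℝ => ∑ u, x u) '' FeasSet mem c d)

/-- Strict scalability step in the proof of Theorem 1: for `α > 1`, strictly positive
demands, and capacities `c'` with `c'_{ju} > c_{ju}/α` on every member pair,
`V(c',d) < α · V(c,d)`. -/
theorem optVal_scalability {U J : Type*} [Fintype U] [Fintype J] [Nonempty U] [Nonempty J]
    (mem : J → U → Prop) [∀ j u, Decidable (mem j u)]
    (c c' : J → U → ℝ) (d : J → ℝ) (α : ℝ) (hα : 1 < α)
    (hcover : ∀ j, ∃ u, mem j u)
    (hc : ∀ j u, mem j u → 0 < c j u)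
    (hcc' : ∀ j u, mem j u → c j u / α < c' j u)
    (hd : ∀ j, 0 < d j) :
    optVal mem c' d < α * optVal mem c d := by
  have hα0 : 0 < α := by linarith
  obtain ⟨β, ⟨hβ, hβ0⟩, hβα⟩ : ∃ β, ((∀ j u, mem j u → c j u < β * c' j u) ∧ 0 < β) ∧ β < α := by
    have h1 : ∀ᶠ β in nhdsWithin α (Set.Iio α), ∀ j u, mem j u → c j u < β * c' j u := by
      rw [Filter.eventually_all]
      intro j
      rw [Filter.eventually_all]
      intro u
      by_cases h : mem j u
      · have h2 : c j u < α * c' j u := by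
          have := hcc' j u h
          rw [div_lt_iff₀ hα0] at this
          linarith
        have hcont : ContinuousAt (fun β : ℝ => β * c' j u) α := by fun_prop
        have h3 : ∀ᶠ β in nhds α, c j u < β * c' j u := hcont.eventually (lt_mem_nhds h2)
        filter_upwards [nhdsWithin_le_nhds h3] with β hβ _ using hβ
      · exact Filter.Eventually.of_forall fun β h' => absurd h' h
    have h2 : ∀ᶠ β in nhdsWithin α (Set.Iio α), 0 < β :=
      nhdsWithin_le_nhds (lt_mem_nhds hα0)
    exact ((h1.and h2).and self_mem_nhdsWithin).exists
  have bdd : BddBelow ((fun x : U → ℝ => ∑ u, x u) '' FeasSet mem c' d) := by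
    refine ⟨0, ?_⟩
    rintro _ ⟨x, hx, rfl⟩
    exact Finset.sum_nonneg fun u _ => hx.1 u
  have hne : ((fun x : U → ℝ => ∑ u, x u) '' FeasSet mem c d).Nonempty := by
    refine Set.Nonempty.image _ ?_
    choose f hf using hcover
    have hp : ∀ j, 0 < d j / c j (f j) := fun j => div_pos (hd j) (hc j _ (hf j))
    have hK : ∀ j, d j / c j (f j) ≤ ∑ i, d i / c i (f i) := fun j =>
      Finset.single_le_sum (f := fun i => d i / c i (f i)) (fun i _ => (hp i).le)
        (Finset.mem_univ j)
    have hK0 : 0 ≤ ∑ i, d i / c i (f i) := Finset.sum_nonneg fun i _ => (hp i).le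
    refine ⟨fun _ => ∑ i, d i / c i (f i), fun _ => hK0, fun j => ?_⟩
    have h1 : d j ≤ c j (f j) * ∑ i, d i / c i (f i) := by
      have := hK j
      rw [div_le_iff₀ (hc j _ (hf j))] at this
      linarith
    refine h1.trans ?_
    refine Finset.single_le_sum (f := fun u => c j u * ∑ i, d i / c i (f i)) (fun u hu => ?_) ?_
    · exact mul_nonneg (hc j u (Finset.mem_filter.1 hu).2).le hK0
    · simp [hf j]
  have hpos : 0 < optVal mem c d := by
    obtain ⟨j⟩ := ‹Nonempty J›
    obtain ⟨v, hv⟩ := hcover j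
    set S := Finset.univ.filter (fun u => mem j u) with hS
    have hcS : ∀ u ∈ S, 0 < c j u := fun u hu => hc j u (Finset.mem_filter.1 hu).2
    have hM : 0 < ∑ u ∈ S, c j u := Finset.sum_pos hcS ⟨v, by simp [hS, hv]⟩
    refine lt_of_lt_of_le (div_pos (hd j) hM) (le_csInf hne ?_)
    rintro _ ⟨x, hx, rfl⟩
    rw [div_le_iff₀ hM]
    refine (hx.2 j).trans ?_
    calc ∑ u ∈ S, c j u * x u ≤ ∑ u ∈ S, c j u * ∑ w, x w := by
          refine Finset.sum_le_sum fun u hu => mul_le_mul_of_nonneg_left ?_ (hcS u hu).le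
          exact Finset.single_le_sum (fun w _ => hx.1 w) (Finset.mem_univ u)
      _ = (∑ w, x w) * ∑ u ∈ S, c j u := by rw [← Finset.sum_mul, mul_comm]
  have hle : optVal mem c' d ≤ β * optVal mem c d := by
    rw [← div_le_iff₀' hβ0]
    refine le_csInf hne ?_
    rintro _ ⟨x, hx, rfl⟩
    rw [div_le_iff₀' hβ0]
    refine csInf_le bdd ⟨fun u => β * x u, ⟨fun u => mul_nonneg hβ0.le (hx.1 u), fun j => ?_⟩, ?_⟩
    · refine (hx.2 j).trans (Finset.sum_le_sum fun u hu => ?_)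
      have := mul_le_mul_of_nonneg_right (hβ j u (Finset.mem_filter.1 hu).2).le (hx.1 u)
      linarith
    · simp [Finset.mul_sum]
  exact hle.trans_lt (mul_lt_mul_of_pos_right hβα hpos)
end

section
/- (Theorem 1, scalability part.) Assume in addition that every cell serves at least one UE and that d_j > 0 for every UE j. Then for every cell i, every α > 1 and every ρ ∈ ℝ^n with ρ ≥ 0, one has f_i(αρ) < α · f_i(ρ); equivalently, f(αρ) < α·f(ρ) strictly in every component. Together with monotonicity, f is a standard interference function. -/
open Finset
open scoped Classical

/-- Multi-cell NOMA load-coupling model: `n` cells, a finite set `J` of UEs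
(each served by exactly one cell), and a finite index type `C` of candidate UE clusters. -/
structure NomaModel (n : ℕ) (J C : Type) [Fintype J] [Fintype C] where
  /-- the serving cell of each UE -/
  serving : J → Fin n
  /-- the cell that each cluster belongs to -/
  cell : C → Fin n
  /-- the UEs forming each cluster -/
  members : C → Finset J
  /-- channel gain from cell `k` to UE `j` -/
  g : Fin n → J → ℝ
  /-- per-RB transmit power of each cell -/
  p : Fin n → ℝ
  /-- intra-cluster power split: power allocated to UE `j` within cluster `u` -/
  psplit : C → J → ℝ
  /-- decoding order on each cluster -/
  b : C → J → ℕ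
  /-- noise power -/
  σsq : ℝ
  /-- number of RBs -/
  M : ℝ
  /-- per-RB bandwidth -/
  B : ℝ
  /-- UE demands -/
  d : J → ℝ
  /-- load limit -/
  ρbar : ℝ
  members_nonempty : ∀ u, (members u).Nonempty
  members_served : ∀ u, ∀ j ∈ members u, serving j = cell u
  covers : ∀ j, ∃ u, j ∈ members u
  g_pos : ∀ k j, 0 < g k j
  p_pos : ∀ k, 0 < p k
  psplit_pos : ∀ u, ∀ j ∈ members u, 0 < psplit u j
  psplit_sum : ∀ u, ∑ j ∈ members u, psplit u j = p (cell u)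
  b_injOn : ∀ u, Set.InjOn (b u) (members u)
  σsq_pos : 0 < σsq
  M_pos : 0 < M
  B_pos : 0 < B
  d_nonneg : ∀ j, 0 ≤ d j
  ρbar_pos : 0 < ρbar
  ρbar_le_one : ρbar ≤ 1

namespace NomaModel

variable {n : ℕ} {J C : Type} [Fintype J] [Fintype C]

/-- SINR of UE `j` in cluster `u` under load vector `ρ` (eq. (1) with averaged
inter-cell interference (2)). -/
noncomputable def sinr (mdl : NomaModel n J C) (ρ : Fin n → ℝ) (u : C) (j : J) : ℝ :=
  mdl.psplit u j * mdl.g (mdl.cell u) j /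
    ((∑ h ∈ (mdl.members u).filter (fun h => mdl.b u h < mdl.b u j),
        mdl.psplit u h * mdl.g (mdl.cell u) j)
      + (∑ k ∈ Finset.univ.filter (fun k => k ≠ mdl.cell u), mdl.p k * mdl.g k j * ρ k)
      + mdl.σsq)

/-- Total capacity over all RBs for UE `j` in cluster `u` (eq. (3)). -/
noncomputable def cap (mdl : NomaModel n J C) (ρ : Fin n → ℝ) (u : C) (j : J) : ℝ :=
  mdl.M * mdl.B * Real.log (1 + mdl.sinr ρ u j)

/-- A load vector `ρ` is feasible if `0 ≤ ρ_i ≤ ρ̄` for every cell and some nonnegative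
resource allocation `x` over clusters realizes the loads and meets all UE demands
(eqs. (1)–(5)). -/
noncomputable def Feasible (mdl : NomaModel n J C) (ρ : Fin n → ℝ) : Prop :=
  (∀ i, 0 ≤ ρ i ∧ ρ i ≤ mdl.ρbar) ∧
  ∃ x : C → ℝ, (∀ u, 0 ≤ x u) ∧
    (∀ i, ρ i = ∑ u ∈ Finset.univ.filter (fun u => mdl.cell u = i), x u) ∧
    (∀ j, mdl.d j ≤ ∑ u ∈ Finset.univ.filter (fun u => j ∈ mdl.members u),
      mdl.cap ρ u j * x u)

/-- Per-cell minimum-load function `f_i(ρ)` (eqs. (7)/(8)): the minimum load of cell `i`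
needed to serve the demands of its UEs, given the other cells' loads `ρ`. -/
noncomputable def f (mdl : NomaModel n J C) (ρ : Fin n → ℝ) (i : Fin n) : ℝ :=
  sInf { s : ℝ | ∃ x : C → ℝ, (∀ u, 0 ≤ x u) ∧
    (∀ j, mdl.serving j = i →
      mdl.d j ≤ ∑ u ∈ Finset.univ.filter (fun u => mdl.cell u = i ∧ j ∈ mdl.members u),
        mdl.cap ρ u j * x u) ∧
    s = ∑ u ∈ Finset.univ.filter (fun u => mdl.cell u = i), x u }

end NomaModel

namespace NomaModel

theorem den_pos_aux {n : ℕ} {J C : Type} [Fintype J] [Fintype C]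
    (mdl : NomaModel n J C) (ρ : Fin n → ℝ) (hρ : ∀ i, 0 ≤ ρ i) (u : C) (j : J) :
    0 ≤ (∑ h ∈ (mdl.members u).filter (fun h => mdl.b u h < mdl.b u j),
        mdl.psplit u h * mdl.g (mdl.cell u) j) ∧
    0 ≤ (∑ k ∈ Finset.univ.filter (fun k => k ≠ mdl.cell u), mdl.p k * mdl.g k j * ρ k) := by
  constructor
  · refine Finset.sum_nonneg fun h hh => ?_
    exact (mul_pos (mdl.psplit_pos u h (Finset.mem_filter.1 hh).1) (mdl.g_pos _ _)).le
  · refine Finset.sum_nonneg fun k _ => ?_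
    exact mul_nonneg (mul_pos (mdl.p_pos k) (mdl.g_pos _ _)).le (hρ k)

theorem sinr_pos_aux {n : ℕ} {J C : Type} [Fintype J] [Fintype C]
    (mdl : NomaModel n J C) (ρ : Fin n → ℝ) (hρ : ∀ i, 0 ≤ ρ i) (u : C) (j : J)
    (hj : j ∈ mdl.members u) : 0 < mdl.sinr ρ u j := by
  obtain ⟨h1, h2⟩ := den_pos_aux mdl ρ hρ u j
  have h3 := mdl.σsq_pos
  unfold sinr
  exact div_pos (mul_pos (mdl.psplit_pos u j hj) (mdl.g_pos _ _)) (by linarith)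

theorem cap_pos_aux {n : ℕ} {J C : Type} [Fintype J] [Fintype C]
    (mdl : NomaModel n J C) (ρ : Fin n → ℝ) (hρ : ∀ i, 0 ≤ ρ i) (u : C) (j : J)
    (hj : j ∈ mdl.members u) : 0 < mdl.cap ρ u j := by
  have := sinr_pos_aux mdl ρ hρ u j hj
  unfold cap
  exact mul_pos (mul_pos mdl.M_pos mdl.B_pos) (Real.log_pos (by linarith))

theorem sinr_scale_aux {n : ℕ} {J C : Type} [Fintype J] [Fintype C]
    (mdl : NomaModel n J C) (α : ℝ) (hα : 1 < α) (ρ : Fin n → ℝ) (hρ : ∀ i, 0 ≤ ρ i)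
    (u : C) (j : J) (hj : j ∈ mdl.members u) :
    mdl.sinr ρ u j / α < mdl.sinr (fun k => α * ρ k) u j := by
  obtain ⟨h1, h2⟩ := den_pos_aux mdl ρ hρ u j
  have h3 := mdl.σsq_pos
  have hA := mul_pos (mdl.psplit_pos u j hj) (mdl.g_pos (mdl.cell u) j)
  have e : (∑ k ∈ Finset.univ.filter (fun k => k ≠ mdl.cell u),
      mdl.p k * mdl.g k j * (α * ρ k)) =
      α * ∑ k ∈ Finset.univ.filter (fun k => k ≠ mdl.cell u), mdl.p k * mdl.g k j * ρ k := by
    rw [Finset.mul_sum]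
    exact Finset.sum_congr rfl fun k _ => by ring
  unfold sinr
  rw [e, div_div]
  generalize (∑ k ∈ Finset.univ.filter (fun k => k ≠ mdl.cell u),
    mdl.p k * mdl.g k j * ρ k) = I at *
  generalize (∑ h ∈ (mdl.members u).filter (fun h => mdl.b u h < mdl.b u j),
        mdl.psplit u h * mdl.g (mdl.cell u) j) = S at *
  apply div_lt_div_of_pos_left hA
  · have : 0 ≤ α * I := mul_nonneg (by linarith) h2
    linarith
  · nlinarith [mul_pos (sub_pos.2 hα) h3, mul_nonneg (sub_pos.2 hα).le h1]

theorem cap_scale_aux {n : ℕ} {J C : Type} [Fintype J] [Fintype C]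
    (mdl : NomaModel n J C) (α : ℝ) (hα : 1 < α) (ρ : Fin n → ℝ) (hρ : ∀ i, 0 ≤ ρ i)
    (u : C) (j : J) (hj : j ∈ mdl.members u) :
    mdl.cap ρ u j < α * mdl.cap (fun k => α * ρ k) u j := by
  have hs := sinr_scale_aux mdl α hα ρ hρ u j hj
  have ht := sinr_pos_aux mdl ρ hρ u j hj
  have hMB := mul_pos mdl.M_pos mdl.B_pos
  have hα0 : 0 < α := by linarith
  unfold cap
  generalize mdl.sinr ρ u j = t at *
  generalize mdl.sinr (fun k => α * ρ k) u j = s at *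
  have hta : 0 < t / α := div_pos ht hα0
  have hb := one_add_mul_self_le_rpow_one_add (s := t / α) (by linarith) hα.le
  rw [mul_div_cancel₀ _ hα0.ne'] at hb
  have h1 : Real.log (1 + t) ≤ α * Real.log (1 + t / α) := by
    rw [← Real.log_rpow (by linarith)]
    exact Real.log_le_log (by linarith) hb
  have h2 : Real.log (1 + t / α) < Real.log (1 + s) :=
    Real.log_lt_log (by linarith) (by linarith)
  have h3 : Real.log (1 + t) < α * Real.log (1 + s) :=
    h1.trans_lt (mul_lt_mul_of_pos_left h2 hα0)
  calc _ < mdl.M * mdl.B * (α * Real.log (1 + s)) := mul_lt_mul_of_pos_left h3 hMB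
    _ = _ := by ring

theorem exists_theta_aux {n : ℕ} {J C : Type} [Fintype J] [Fintype C]
    (mdl : NomaModel n J C) (α : ℝ) (hα : 1 < α) (ρ : Fin n → ℝ) (hρ : ∀ i, 0 ≤ ρ i) :
    ∃ θ : ℝ, 0 < θ ∧ θ < α ∧ ∀ u j, j ∈ mdl.members u →
      mdl.cap ρ u j ≤ θ * mdl.cap (fun k => α * ρ k) u j := by
  have h : ∀ᶠ θ in nhdsWithin α (Set.Iio α), ∀ u j, j ∈ mdl.members u →
      mdl.cap ρ u j ≤ θ * mdl.cap (fun k => α * ρ k) u j := by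
    rw [Filter.eventually_all]
    intro u
    rw [Filter.eventually_all]
    intro j
    by_cases hj : j ∈ mdl.members u
    · have hc : ContinuousAt (fun θ : ℝ => θ * mdl.cap (fun k => α * ρ k) u j) α := by
        fun_prop
      have := hc.eventually (lt_mem_nhds (cap_scale_aux mdl α hα ρ hρ u j hj))
      filter_upwards [nhdsWithin_le_nhds this] with θ hθ _
      exact le_of_lt hθ
    · exact Filter.Eventually.of_forall fun θ h => absurd h hj
  have h0 : ∀ᶠ θ in nhdsWithin α (Set.Iio α), (0 : ℝ) < θ :=
    nhdsWithin_le_nhds (lt_mem_nhds (by linarith))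
  obtain ⟨θ, ⟨h1, h2⟩, h3⟩ := ((h.and h0).and self_mem_nhdsWithin).exists
  exact ⟨θ, h2, h3, h1⟩

/-- The set of attainable loads. -/
def loadSet {n : ℕ} {J C : Type} [Fintype J] [Fintype C]
    (mdl : NomaModel n J C) (ρ : Fin n → ℝ) (i : Fin n) : Set ℝ :=
  { s : ℝ | ∃ x : C → ℝ, (∀ u, 0 ≤ x u) ∧
    (∀ j, mdl.serving j = i →
      mdl.d j ≤ ∑ u ∈ Finset.univ.filter (fun u => mdl.cell u = i ∧ j ∈ mdl.members u),
        mdl.cap ρ u j * x u) ∧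
    s = ∑ u ∈ Finset.univ.filter (fun u => mdl.cell u = i), x u }

theorem loadSet_nonempty {n : ℕ} {J C : Type} [Fintype J] [Fintype C]
    (mdl : NomaModel n J C) (ρ : Fin n → ℝ) (hρ : ∀ i, 0 ≤ ρ i) (i : Fin n) :
    (mdl.loadSet ρ i).Nonempty := by
  choose v hv using mdl.covers
  have hq : ∀ j, 0 ≤ mdl.d j / mdl.cap ρ (v j) j := fun j =>
    div_nonneg (mdl.d_nonneg j) (cap_pos_aux mdl ρ hρ _ j (hv j)).le
  have hT : 0 ≤ ∑ j, mdl.d j / mdl.cap ρ (v j) j := Finset.sum_nonneg fun j _ => hq j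
  refine ⟨_, fun _ => ∑ j, mdl.d j / mdl.cap ρ (v j) j, fun _ => hT, fun j hj => ?_, rfl⟩
  have hc := cap_pos_aux mdl ρ hρ _ j (hv j)
  have h1 : mdl.d j / mdl.cap ρ (v j) j ≤ ∑ j, mdl.d j / mdl.cap ρ (v j) j :=
    Finset.single_le_sum (f := fun j => mdl.d j / mdl.cap ρ (v j) j)
      (fun j _ => hq j) (Finset.mem_univ j)
  have h2 : mdl.d j ≤ mdl.cap ρ (v j) j * ∑ j, mdl.d j / mdl.cap ρ (v j) j := by
    rwa [div_le_iff₀' hc] at h1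
  refine h2.trans ?_
  refine Finset.single_le_sum
    (f := fun u => mdl.cap ρ u j * ∑ j, mdl.d j / mdl.cap ρ (v j) j) (fun u hu => ?_) ?_
  · exact mul_nonneg (cap_pos_aux mdl ρ hρ u j (Finset.mem_filter.1 hu).2.2).le hT
  · exact Finset.mem_filter.2 ⟨Finset.mem_univ _,
      (mdl.members_served _ _ (hv j)).symm.trans hj, hv j⟩

theorem f_pos_aux {n : ℕ} {J C : Type} [Fintype J] [Fintype C]
    (mdl : NomaModel n J C) (hserve : ∀ i : Fin n, ∃ j : J, mdl.serving j = i)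
    (hd : ∀ j, 0 < mdl.d j) (ρ : Fin n → ℝ) (hρ : ∀ i, 0 ≤ ρ i) (i : Fin n) :
    0 < mdl.f ρ i := by
  obtain ⟨j, hj⟩ := hserve i
  have hK : 0 < 1 + ∑ u, |mdl.cap ρ u j| := by
    have : 0 ≤ ∑ u, |mdl.cap ρ u j| := Finset.sum_nonneg fun u _ => abs_nonneg _
    linarith
  have hle : ∀ u, mdl.cap ρ u j ≤ 1 + ∑ u, |mdl.cap ρ u j| := fun u => by
    have := Finset.single_le_sum (f := fun u => |mdl.cap ρ u j|)
      (fun u _ => abs_nonneg _) (Finset.mem_univ u)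
    have h2 := le_abs_self (mdl.cap ρ u j)
    linarith
  generalize 1 + ∑ u, |mdl.cap ρ u j| = K at hK hle
  refine lt_of_lt_of_le (div_pos (hd j) hK) (le_csInf (loadSet_nonempty mdl ρ hρ i) ?_)
  rintro s ⟨x, hx, hdem, rfl⟩
  rw [div_le_iff₀' hK, Finset.mul_sum]
  refine (hdem j hj).trans ?_
  refine (Finset.sum_le_sum fun u _ => mul_le_mul_of_nonneg_right (hle u) (hx u)).trans ?_
  refine Finset.sum_le_sum_of_subset_of_nonneg (fun u hu => ?_)
    fun u _ _ => mul_nonneg hK.le (hx u)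
  exact Finset.mem_filter.2 ⟨Finset.mem_univ _, (Finset.mem_filter.1 hu).2.1⟩

end NomaModel

/-- Theorem 1, scalability part: if every cell serves at least one UE and all demands
are strictly positive, then for every cell `i`, every `α > 1` and every `ρ ≥ 0`,
`f_i(αρ) < α · f_i(ρ)`. Together with monotonicity, `f` is a standard interference
function. -/
theorem NomaModel.f_scalable {n : ℕ} {J C : Type} [Fintype J] [Fintype C]
    (mdl : NomaModel n J C)
    (hserve : ∀ i : Fin n, ∃ j : J, mdl.serving j = i)
    (hd : ∀ j, 0 < mdl.d j)
    (α : ℝ) (hα : 1 < α) (ρ : Fin n → ℝ) (hρ : ∀ i, 0 ≤ ρ i) :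
    ∀ i, mdl.f (fun k => α * ρ k) i < α * mdl.f ρ i := by
  intro i
  obtain ⟨θ, hθ, hθα, hcap⟩ := exists_theta_aux mdl α hα ρ hρ
  have hf := f_pos_aux mdl hserve hd ρ hρ i
  have key : mdl.f (fun k => α * ρ k) i / θ ≤ mdl.f ρ i := by
    refine le_csInf (loadSet_nonempty mdl ρ hρ i) ?_
    rintro s ⟨x, hx, hdem, rfl⟩
    rw [div_le_iff₀' hθ]
    refine csInf_le ⟨0, ?_⟩ ⟨fun u => θ * x u, fun u => mul_nonneg hθ.le (hx u), ?_, ?_⟩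
    · rintro s ⟨y, hy, _, rfl⟩
      exact Finset.sum_nonneg fun u _ => hy u
    · intro j hj
      refine (hdem j hj).trans (Finset.sum_le_sum fun u hu => ?_)
      have := mul_le_mul_of_nonneg_right (hcap u j (Finset.mem_filter.1 hu).2.2) (hx u)
      calc _ ≤ _ := this
        _ = _ := by ring
    · rw [Finset.mul_sum]
  rw [div_le_iff₀' hθ] at key
  exact key.trans_lt (mul_lt_mul_of_pos_right hθα hf)
end

section
/- A standard interference function has at most one fixed point: if f is an SIF and ρ, ρ' ∈ ℝ^n_{≥0} satisfy f(ρ) = ρ and f(ρ') = ρ', then ρ = ρ' (uniqueness of the fixed point used throughout Section III). -/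
/-- A standard interference function (SIF) on the nonnegative orthant of `ℝ^n`:
it maps the orthant into itself, is monotone (componentwise), and is scalable:
`f(αρ) < α·f(ρ)` strictly in every component, for all `α > 1`. -/
def IsSIF (n : ℕ) (f : (Fin n → ℝ) → (Fin n → ℝ)) : Prop :=
  (∀ ρ : Fin n → ℝ, (∀ i, 0 ≤ ρ i) → ∀ i, 0 ≤ f ρ i) ∧
  (∀ ρ ρ' : Fin n → ℝ, (∀ i, 0 ≤ ρ i) → (∀ i, 0 ≤ ρ' i) →
    (∀ i, ρ i ≤ ρ' i) → ∀ i, f ρ i ≤ f ρ' i) ∧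
  (∀ α : ℝ, 1 < α → ∀ ρ : Fin n → ℝ, (∀ i, 0 ≤ ρ i) →
    ∀ i, f (fun k => α * ρ k) i < α * f ρ i)

theorem sif_fixedPoint_le_aux {n : ℕ} (f : (Fin n → ℝ) → (Fin n → ℝ)) (hf : IsSIF n f)
    (ρ ρ' : Fin n → ℝ) (hρ : ∀ i, 0 ≤ ρ i) (hρ' : ∀ i, 0 ≤ ρ' i)
    (hfix : f ρ = ρ) (hfix' : f ρ' = ρ') (j : Fin n) : ρ j ≤ ρ' j := by
  obtain ⟨hnn, hmono, hscal⟩ := hf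
  have hpos : ∀ i, 0 < ρ' i := by
    intro i
    have h1 := hscal 2 (by norm_num) ρ' hρ' i
    have h2 := hnn (fun k => 2 * ρ' k) (fun k => by have := hρ' k; positivity) i
    rw [hfix'] at h1
    linarith
  by_contra! hlt
  obtain ⟨i, -, hi⟩ := Finset.exists_max_image Finset.univ (fun k => ρ k / ρ' k)
    ⟨j, Finset.mem_univ j⟩
  have hα : 1 < ρ i / ρ' i :=
    lt_of_lt_of_le ((one_lt_div (hpos j)).2 hlt) (hi j (Finset.mem_univ j))
  have h1 := hscal _ hα ρ' hρ' i
  have h2 := hmono ρ (fun k => ρ i / ρ' i * ρ' k) hρ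
    (fun k => mul_nonneg (by linarith) (hρ' k))
    (fun k => (div_le_iff₀ (hpos k)).1 (hi k (Finset.mem_univ k))) i
  rw [hfix', div_mul_cancel₀ _ (hpos i).ne'] at h1
  rw [hfix] at h2
  linarith

/-- Uniqueness of the fixed point of a standard interference function. -/
theorem sif_fixedPoint_unique {n : ℕ} (f : (Fin n → ℝ) → (Fin n → ℝ)) (hf : IsSIF n f)
    (ρ ρ' : Fin n → ℝ) (hρ : ∀ i, 0 ≤ ρ i) (hρ' : ∀ i, 0 ≤ ρ' i)
    (hfix : f ρ = ρ) (hfix' : f ρ' = ρ') : ρ = ρ' := by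
  funext j
  exact le_antisymm (sif_fixedPoint_le_aux f hf ρ ρ' hρ hρ' hfix hfix' j)
    (sif_fixedPoint_le_aux f hf ρ' ρ hρ' hρ hfix' hfix j)
end

section
/- (Lemma 4 / convergence of fixed-point iterations.) Let f be an SIF that admits a fixed point ρ* ∈ ℝ^n_{≥0}. Then for every starting point ρ⁰ ∈ ℝ^n_{≥0}, the sequence of iterates ρ^{(k)} = f(ρ^{(k−1)}), k ≥ 1, converges to ρ*; in particular lim_{k→∞} f^k(ρ⁰) exists, is the same for all starting points, and is independent of ρ⁰. -/
theorem sif_aux_inf (P : ℝ → Prop) (hne : ∃ a, P a) (hup : ∀ a b, P a → a ≤ b → P b)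
    (hstep : ∀ a, 1 < a → ∃ β, 0 < β ∧ β < a ∧ ∀ γ, a ≤ γ → P γ → P (β * (γ / a))) :
    ∀ c, 1 < c → P c := by
  intro c hc
  by_contra hPc
  have hlb : ∀ x ∈ {x | P x}, c ≤ x := by
    intro x hx
    by_contra h
    exact hPc (hup x c hx (le_of_lt (not_le.mp h)))
  have hbdd : BddBelow {x | P x} := ⟨c, hlb⟩
  have hne' : {x | P x}.Nonempty := hne
  have hca : c ≤ sInf {x | P x} := le_csInf hne' hlb
  set a := sInf {x | P x} with ha
  obtain ⟨β, hβ0, hβa, hβ⟩ := hstep a (by linarith)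
  have ha0 : 0 < a := by linarith
  have hlt : a < a * (a / β) := by
    have : 1 < a / β := by rwa [one_lt_div hβ0]
    nlinarith
  obtain ⟨γ, hγ, hγlt⟩ := exists_lt_of_csInf_lt hne' (ha ▸ hlt)
  have h1 : a ≤ γ := csInf_le hbdd hγ
  have h2 : a ≤ β * (γ / a) := csInf_le hbdd (hβ γ h1 hγ)
  have h3 : β * (γ / a) < a := by
    have : β * (γ / a) < β * ((a * (a / β)) / a) := by gcongr
    have h4 : β * ((a * (a / β)) / a) = a := by field_simp
    linarith
  linarith

theorem sif_aux_beta {n : ℕ} (x y : Fin n → ℝ) (a : ℝ) (ha : 0 < a)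
    (h : ∀ i, x i < a * y i) : ∃ β, 0 < β ∧ β < a ∧ ∀ i, x i ≤ β * y i := by
  have h1 : ∀ᶠ β in nhdsWithin a (Set.Iio a), ∀ i, x i < β * y i := by
    rw [Filter.eventually_all]
    intro i
    apply Filter.Eventually.filter_mono nhdsWithin_le_nhds
    have : Filter.Tendsto (fun β : ℝ => β * y i) (nhds a) (nhds (a * y i)) :=
      (continuous_id.mul continuous_const).tendsto a
    exact this.eventually (lt_mem_nhds (h i))
  have h2 : ∀ᶠ β in nhdsWithin a (Set.Iio a), 0 < β :=
    (lt_mem_nhds ha).filter_mono nhdsWithin_le_nhds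
  obtain ⟨β, hb1, hb2, hb3⟩ := (h1.and (h2.and self_mem_nhdsWithin)).exists
  exact ⟨β, hb2, hb3, fun i => (hb1 i).le⟩

/-- Lemma 4 / convergence of fixed-point iterations: if an SIF `f` admits a fixed point
`ρ*` in the nonnegative orthant, then from every starting point `ρ⁰` in the orthant the
iterates `f^[k] ρ⁰` converge to `ρ*` (so the limit exists and is independent of `ρ⁰`). -/
theorem sif_iterates_tendsto_fixedPoint {n : ℕ} (f : (Fin n → ℝ) → (Fin n → ℝ))
    (hf : IsSIF n f) (ρstar : Fin n → ℝ) (hρstar : ∀ i, 0 ≤ ρstar i)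
    (hfix : f ρstar = ρstar) :
    ∀ ρ0 : Fin n → ℝ, (∀ i, 0 ≤ ρ0 i) →
      Filter.Tendsto (fun k : ℕ => f^[k] ρ0) Filter.atTop (nhds ρstar) := by
  intro ρ0 hρ0
  obtain ⟨hnn, hmono, hscal⟩ := hf
  have hpos : ∀ ρ : Fin n → ℝ, (∀ i, 0 ≤ ρ i) → ∀ i, 0 < f ρ i := by
    intro ρ hρ i
    have h1 := hscal 2 (by norm_num) ρ hρ i
    have h2 := hnn (fun k => 2 * ρ k) (fun k => mul_nonneg (by norm_num) (hρ k)) i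
    linarith
  have hscal' : ∀ α : ℝ, 1 ≤ α → ∀ ρ : Fin n → ℝ, (∀ i, 0 ≤ ρ i) →
      ∀ i, f (fun k => α * ρ k) i ≤ α * f ρ i := by
    intro α hα ρ hρ i
    rcases hα.eq_or_lt with rfl | h
    · simp
    · exact (hscal α h ρ hρ i).le
  have hs : ∀ i, 0 < ρstar i := by
    intro i
    have := hpos ρstar hρstar i
    rwa [hfix] at this
  have hit : ∀ k i, 0 ≤ f^[k] ρ0 i := by
    intro k
    induction k with
    | zero => exact hρ0
    | succ k ih => rw [Function.iterate_succ_apply']; exact hnn _ ih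
  -- upper bounds
  have hU : ∀ c, 1 < c → ∃ k, ∀ i, f^[k] ρ0 i ≤ c * ρstar i := by
    apply sif_aux_inf
    · refine ⟨∑ j, ρ0 j / ρstar j, 0, fun i => ?_⟩
      have : ρ0 i / ρstar i ≤ ∑ j, ρ0 j / ρstar j :=
        Finset.single_le_sum (f := fun j => ρ0 j / ρstar j)
          (fun j _ => div_nonneg (hρ0 j) (hρstar j)) (Finset.mem_univ i)
      rw [div_le_iff₀ (hs i)] at this
      exact this
    · rintro a b ⟨k, hk⟩ hab
      exact ⟨k, fun i => (hk i).trans (mul_le_mul_of_nonneg_right hab (hρstar i))⟩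
    · intro a ha
      have ha0 : 0 < a := by linarith
      have hn : ∀ i, 0 ≤ a * ρstar i := fun i => mul_nonneg ha0.le (hρstar i)
      obtain ⟨β, h0, h1, h2⟩ := sif_aux_beta (f (fun k => a * ρstar k)) ρstar a ha0
        (fun i => by have := hscal a ha ρstar hρstar i; rwa [hfix] at this)
      refine ⟨β, h0, h1, ?_⟩
      rintro γ hγ ⟨k, hk⟩
      refine ⟨k + 1, fun i => ?_⟩
      rw [Function.iterate_succ_apply']
      have hg : 1 ≤ γ / a := by rwa [one_le_div ha0]
      have e : ∀ i, γ / a * (a * ρstar i) = γ * ρstar i := by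
        intro i; field_simp
      have h3 := hmono (f^[k] ρ0) (fun i => γ / a * (a * ρstar i)) (hit k)
        (fun i => mul_nonneg (by linarith) (hn i)) (fun i => by rw [e]; exact hk i) i
      have h4 := hscal' (γ / a) hg (fun k => a * ρstar k) hn i
      have h5 := mul_le_mul_of_nonneg_left (h2 i) (by linarith : 0 ≤ γ / a)
      calc _ ≤ _ := h3
        _ ≤ _ := h4
        _ ≤ _ := h5
        _ = _ := by ring
  -- lower bounds
  have hL : ∀ c, 1 < c → ∃ k, ∀ i, ρstar i ≤ c * f^[k] ρ0 i := by
    apply sif_aux_inf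
    · have hp := hpos ρ0 hρ0
      refine ⟨∑ j, ρstar j / f ρ0 j, 1, fun i => ?_⟩
      have : ρstar i / f ρ0 i ≤ ∑ j, ρstar j / f ρ0 j :=
        Finset.single_le_sum (f := fun j => ρstar j / f ρ0 j)
          (fun j _ => div_nonneg (hρstar j) (hp j).le) (Finset.mem_univ i)
      rw [div_le_iff₀ (hp i)] at this
      exact this
    · rintro a b ⟨k, hk⟩ hab
      exact ⟨k, fun i => (hk i).trans (mul_le_mul_of_nonneg_right hab (hit k i))⟩
    · intro a ha
      have ha0 : 0 < a := by linarith
      have hn : ∀ i, 0 ≤ ρstar i / a := fun i => div_nonneg (hρstar i) ha0.le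
      have e0 : (fun k => a * (ρstar k / a)) = ρstar := by
        funext k; field_simp
      obtain ⟨β, h0, h1, h2⟩ := sif_aux_beta ρstar (f (fun k => ρstar k / a)) a ha0
        (fun i => by
          have := hscal a ha (fun k => ρstar k / a) hn i
          rw [e0, hfix] at this
          exact this)
      refine ⟨β, h0, h1, ?_⟩
      rintro γ hγ ⟨k, hk⟩
      refine ⟨k + 1, fun i => ?_⟩
      rw [Function.iterate_succ_apply']
      have hg : 1 ≤ γ / a := by rwa [one_le_div ha0]
      have h3 := hmono (fun i => ρstar i / a) (fun i => γ / a * f^[k] ρ0 i) hn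
        (fun i => mul_nonneg (by linarith) (hit k i))
        (fun i => by
          have := div_le_div_of_nonneg_right (hk i) ha0.le
          calc _ ≤ _ := this
            _ = _ := by ring) i
      have h4 := hscal' (γ / a) hg (f^[k] ρ0) (hit k) i
      calc _ ≤ _ := h2 i
        _ ≤ β * (γ / a * f (f^[k] ρ0) i) :=
          mul_le_mul_of_nonneg_left (h3.trans h4) h0.le
        _ = _ := by ring
  have hU' : ∀ c, 1 < c → ∀ᶠ k in Filter.atTop, ∀ i, f^[k] ρ0 i ≤ c * ρstar i := by
    intro c hc
    obtain ⟨k, hk⟩ := hU c hc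
    filter_upwards [Filter.eventually_ge_atTop k] with m hm
    induction m, hm using Nat.le_induction with
    | base => exact hk
    | succ m _ ih =>
      intro i
      rw [Function.iterate_succ_apply']
      have h3 := hmono (f^[m] ρ0) (fun i => c * ρstar i) (hit m)
        (fun i => mul_nonneg (by linarith) (hρstar i)) ih i
      have h4 := hscal c hc ρstar hρstar i
      rw [hfix] at h4
      exact h3.trans h4.le
  have hL' : ∀ c, 1 < c → ∀ᶠ k in Filter.atTop, ∀ i, ρstar i ≤ c * f^[k] ρ0 i := by
    intro c hc
    obtain ⟨k, hk⟩ := hL c hc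
    filter_upwards [Filter.eventually_ge_atTop k] with m hm
    induction m, hm using Nat.le_induction with
    | base => exact hk
    | succ m _ ih =>
      intro i
      rw [Function.iterate_succ_apply']
      have h3 := hmono ρstar (fun i => c * f^[m] ρ0 i) hρstar
        (fun i => mul_nonneg (by linarith) (hit m i)) ih i
      have h4 := hscal c hc (f^[m] ρ0) (hit m) i
      rw [hfix] at h3
      exact h3.trans h4.le
  have hc : ∀ x y : ℝ, x < y → ∃ c, 1 < c ∧ c * x < y := by
    intro x y hxy
    have ht : Filter.Tendsto (fun c : ℝ => c * x) (nhds 1) (nhds (1 * x)) :=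
      (continuous_id.mul continuous_const).tendsto 1
    have h1 : ∀ᶠ c in nhdsWithin (1 : ℝ) (Set.Ioi 1), c * x < y :=
      (ht.eventually (gt_mem_nhds (by linarith))).filter_mono nhdsWithin_le_nhds
    obtain ⟨c, hc1, hc2⟩ := (h1.and self_mem_nhdsWithin).exists
    exact ⟨c, hc2, hc1⟩
  rw [tendsto_pi_nhds]
  intro i
  rw [tendsto_order]
  constructor
  · intro l hl
    obtain ⟨c, hc1, hc2⟩ := hc l (ρstar i) hl
    filter_upwards [hL' c hc1] with k hk
    have := hk i
    exact lt_of_mul_lt_mul_left (hc2.trans_le this) (by linarith)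
  · intro u hu
    obtain ⟨c, hc1, hc2⟩ := hc (ρstar i) u hu
    filter_upwards [hU' c hc1] with k hk
    exact (hk i).trans_lt hc2
end

section
/- Let f be an SIF with fixed point ρ* ∈ ℝ^n_{≥0}. Then every ρ ∈ ℝ^n_{≥0} with f(ρ) ≤ ρ satisfies ρ* ≤ ρ; i.e., the fixed point of an SIF is componentwise minimal among all vectors that dominate their own image (the minimality property underlying the proofs of Theorems 2 and 3). -/
/-- The fixed point of an SIF is componentwise minimal among all nonnegative vectors
dominating their own image: if `f(ρ) ≤ ρ` then `ρ* ≤ ρ`. -/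
theorem sif_fixedPoint_minimal {n : ℕ} (f : (Fin n → ℝ) → (Fin n → ℝ)) (hf : IsSIF n f)
    (ρstar : Fin n → ℝ) (hρstar : ∀ i, 0 ≤ ρstar i) (hfix : f ρstar = ρstar)
    (ρ : Fin n → ℝ) (hρ : ∀ i, 0 ≤ ρ i) (hdom : ∀ i, f ρ i ≤ ρ i) :
    ∀ i, ρstar i ≤ ρ i := by
  obtain ⟨h0, hmono, hscal⟩ := hf
  have hpos : ∀ i, 0 < ρ i := by
    intro i
    have h1 := h0 (fun k => 2 * ρ k) (fun k => mul_nonneg (by norm_num) (hρ k)) i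
    have h2 := hscal 2 (by norm_num) ρ hρ i
    have h3 := hdom i
    linarith
  intro j
  by_contra hj
  have hj' : ρ j < ρstar j := not_le.mp hj
  obtain ⟨i, -, hi⟩ := Finset.exists_max_image Finset.univ (fun k => ρstar k / ρ k)
    ⟨j, Finset.mem_univ j⟩
  have hα : 1 < ρstar i / ρ i :=
    lt_of_lt_of_le ((one_lt_div (hpos j)).mpr hj') (hi j (Finset.mem_univ j))
  have hle : ∀ k, ρstar k ≤ ρstar i / ρ i * ρ k := fun k =>
    (div_le_iff₀ (hpos k)).mp (hi k (Finset.mem_univ k))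
  have h1 := hmono ρstar (fun k => ρstar i / ρ i * ρ k) hρstar
    (fun k => (hρstar k).trans (hle k)) hle i
  have h2 := hscal _ hα ρ hρ i
  have h3 : ρstar i / ρ i * f ρ i ≤ ρstar i / ρ i * ρ i :=
    mul_le_mul_of_nonneg_left (hdom i) (by linarith)
  have h4 : ρstar i / ρ i * ρ i = ρstar i := div_mul_cancel₀ _ (hpos i).ne'
  rw [hfix] at h1
  linarith
end

section
/- (Theorem 3, necessity.) Assume every cell serves at least one UE and d_j > 0 for every UE j. Let F : ℝ^n → ℝ be strictly increasing in the sense that ρ ≤ ρ' componentwise with ρ ≠ ρ' implies F(ρ) < F(ρ'). If ρ* is feasible and F(ρ*) ≤ F(ρ) for every feasible load vector ρ (i.e., ρ* is optimal for MinF), then f(ρ*) = ρ* and ρ*_i ≤ ρ̄ for all i. -/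
open Finset
open scoped Classical

theorem NomaModel.cap_anti {n : ℕ} {J C : Type} [Fintype J] [Fintype C]
    (mdl : NomaModel n J C) (ρ ρ' : Fin n → ℝ) (u : C) (j : J) (hj : j ∈ mdl.members u)
    (h0 : ∀ k, k ≠ mdl.cell u → 0 ≤ ρ k) (h1 : ∀ k, k ≠ mdl.cell u → ρ k ≤ ρ' k) :
    mdl.cap ρ' u j ≤ mdl.cap ρ u j := by
  have hA : 0 ≤ ∑ h ∈ (mdl.members u).filter (fun h => mdl.b u h < mdl.b u j),
        mdl.psplit u h * mdl.g (mdl.cell u) j := by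
    apply Finset.sum_nonneg
    intro h hh
    exact (mul_pos (mdl.psplit_pos u h (Finset.mem_filter.1 hh).1) (mdl.g_pos _ _)).le
  have hpg : ∀ k, 0 ≤ mdl.p k * mdl.g k j := fun k => (mul_pos (mdl.p_pos k) (mdl.g_pos k j)).le
  have hB : 0 ≤ ∑ k ∈ Finset.univ.filter (fun k => k ≠ mdl.cell u),
      mdl.p k * mdl.g k j * ρ k := by
    apply Finset.sum_nonneg
    intro k hk
    exact mul_nonneg (hpg k) (h0 k (Finset.mem_filter.1 hk).2)
  have hBB : ∑ k ∈ Finset.univ.filter (fun k => k ≠ mdl.cell u), mdl.p k * mdl.g k j * ρ k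
      ≤ ∑ k ∈ Finset.univ.filter (fun k => k ≠ mdl.cell u), mdl.p k * mdl.g k j * ρ' k := by
    apply Finset.sum_le_sum
    intro k hk
    exact mul_le_mul_of_nonneg_left (h1 k (Finset.mem_filter.1 hk).2) (hpg k)
  have hn : 0 < mdl.psplit u j * mdl.g (mdl.cell u) j :=
    mul_pos (mdl.psplit_pos u j hj) (mdl.g_pos _ _)
  have hs := mdl.σsq_pos
  have hsinr : mdl.sinr ρ' u j ≤ mdl.sinr ρ u j := by
    unfold NomaModel.sinr
    apply div_le_div_of_nonneg_left hn.le
    · linarith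
    · linarith
  have hpos : 0 ≤ mdl.sinr ρ' u j := by
    unfold NomaModel.sinr
    apply div_nonneg hn.le
    linarith
  unfold NomaModel.cap
  apply mul_le_mul_of_nonneg_left _ (mul_pos mdl.M_pos mdl.B_pos).le
  apply Real.log_le_log <;> linarith

/-- Theorem 3, necessity: assume every cell serves at least one UE and all demands are
strictly positive, and let `F` be strictly increasing (`ρ ≤ ρ'` componentwise with
`ρ ≠ ρ'` implies `F(ρ) < F(ρ')`). If `ρ*` is feasible and optimal for MinF, then
`f(ρ*) = ρ*` and `ρ*_i ≤ ρ̄` for all `i`. -/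
theorem NomaModel.optimal_isFixedPoint {n : ℕ} {J C : Type} [Fintype J] [Fintype C]
    (mdl : NomaModel n J C)
    (hserve : ∀ i : Fin n, ∃ j : J, mdl.serving j = i)
    (hd : ∀ j, 0 < mdl.d j)
    (F : (Fin n → ℝ) → ℝ)
    (hF : ∀ ρ ρ' : Fin n → ℝ, (∀ i, ρ i ≤ ρ' i) → ρ ≠ ρ' → F ρ < F ρ')
    (ρstar : Fin n → ℝ) (hfeas : mdl.Feasible ρstar)
    (hopt : ∀ ρ : Fin n → ℝ, mdl.Feasible ρ → F ρstar ≤ F ρ) :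
    mdl.f ρstar = ρstar ∧ ∀ i, ρstar i ≤ mdl.ρbar := by
  obtain ⟨hb, x, hx0, hxρ, hxd⟩ := hfeas
  refine ⟨?_, fun i => (hb i).2⟩
  have hset : ∀ j, Finset.univ.filter
      (fun u => mdl.cell u = mdl.serving j ∧ j ∈ mdl.members u)
      = Finset.univ.filter (fun u => j ∈ mdl.members u) := by
    intro j
    ext u
    simp only [Finset.mem_filter, Finset.mem_univ, true_and]
    exact ⟨fun h => h.2, fun h => ⟨(mdl.members_served u j h).symm, h⟩⟩
  funext i
  have hmem : ρstar i ∈ { s : ℝ | ∃ x : C → ℝ, (∀ u, 0 ≤ x u) ∧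
    (∀ j, mdl.serving j = i →
      mdl.d j ≤ ∑ u ∈ Finset.univ.filter (fun u => mdl.cell u = i ∧ j ∈ mdl.members u),
        mdl.cap ρstar u j * x u) ∧
    s = ∑ u ∈ Finset.univ.filter (fun u => mdl.cell u = i), x u } := by
    refine ⟨x, hx0, ?_, hxρ i⟩
    intro j hj
    subst hj
    rw [hset]
    exact hxd j
  unfold NomaModel.f
  apply le_antisymm
  · refine csInf_le ⟨0, ?_⟩ hmem
    rintro s ⟨y, hy, -, rfl⟩
    exact Finset.sum_nonneg fun u _ => hy u
  · refine le_csInf ⟨_, hmem⟩ ?_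
    rintro s ⟨y, hy0, hyd, hs⟩
    by_contra hlt
    push Not at hlt
    have hs0 : 0 ≤ s := by
      rw [hs]
      exact Finset.sum_nonneg fun u _ => hy0 u
    set ρ' : Fin n → ℝ := Function.update ρstar i s with hρ'
    have hi : ρ' i = s := by simp [hρ']
    have hne : ∀ k, k ≠ i → ρ' k = ρstar k := fun k hk => by simp [hρ', hk]
    have hle : ∀ k, ρ' k ≤ ρstar k := by
      intro k
      by_cases hk : k = i
      · subst hk
        rw [hi]
        exact hlt.le
      · exact (hne k hk).le
    have hnn : ∀ k, 0 ≤ ρ' k := by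
      intro k
      by_cases hk : k = i
      · subst hk
        rw [hi]
        exact hs0
      · rw [hne k hk]
        exact (hb k).1
    have hneq : ρ' ≠ ρstar := by
      intro h
      rw [h] at hi
      linarith
    have hlt' := hF ρ' ρstar hle hneq
    refine absurd (hopt ρ' ⟨fun k => ⟨hnn k, (hle k).trans (hb k).2⟩,
      fun u => if mdl.cell u = i then y u else x u, ?_, ?_, ?_⟩) (not_le.2 hlt')
    · intro u
      dsimp only
      split_ifs
      · exact hy0 u
      · exact hx0 u
    · intro k
      by_cases hk : k = i
      · subst hk
        rw [hi, hs]
        apply Finset.sum_congr rfl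
        intro u hu
        dsimp only
        rw [if_pos (Finset.mem_filter.1 hu).2]
      · rw [hne k hk, hxρ k]
        apply Finset.sum_congr rfl
        intro u hu
        dsimp only
        rw [if_neg]
        rw [(Finset.mem_filter.1 hu).2]
        exact hk
    · intro j
      by_cases hj : mdl.serving j = i
      · refine (hyd j hj).trans ?_
        subst hj
        rw [hset]
        apply Finset.sum_le_sum
        intro u hu
        have hu' := (Finset.mem_filter.1 hu).2
        dsimp only
        rw [if_pos (mdl.members_served u j hu').symm]
        exact mul_le_mul_of_nonneg_right
          (mdl.cap_anti _ _ u j hu' (fun k _ => hnn k) (fun k _ => hle k)) (hy0 u)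
      · refine (hxd j).trans ?_
        apply Finset.sum_le_sum
        intro u hu
        have hu' := (Finset.mem_filter.1 hu).2
        dsimp only
        rw [if_neg (by rw [← mdl.members_served u j hu']; exact hj)]
        exact mul_le_mul_of_nonneg_right
          (mdl.cap_anti _ _ u j hu' (fun k _ => hnn k) (fun k _ => hle k)) (hx0 u)
end

section
/- (Lemma 5.) Assume every cell serves at least one UE and d_j > 0 for every UE j. There exists a feasible load vector if and only if there exists ρ* ∈ ℝ^n_{≥0} with f(ρ*) = ρ* and ρ*_i ≤ ρ̄ for all i; i.e., the problem MinF is feasible if and only if the function f admits a fixed point within the load limit. -/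
open Finset
open scoped Classical

namespace NomaModel

section helpers

variable {n : ℕ} {J C : Type} [Fintype J] [Fintype C]

/-- Denominator of the SINR is positive. -/
theorem aux_den_pos (mdl : NomaModel n J C) {ρ : Fin n → ℝ} (hρ : ∀ i, 0 ≤ ρ i) (u : C) (j : J) :
    0 < ((∑ h ∈ (mdl.members u).filter (fun h => mdl.b u h < mdl.b u j),
        mdl.psplit u h * mdl.g (mdl.cell u) j)
      + (∑ k ∈ Finset.univ.filter (fun k => k ≠ mdl.cell u), mdl.p k * mdl.g k j * ρ k)
      + mdl.σsq) := by
  have h1 : 0 ≤ ∑ h ∈ (mdl.members u).filter (fun h => mdl.b u h < mdl.b u j),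
        mdl.psplit u h * mdl.g (mdl.cell u) j := by
    apply Finset.sum_nonneg
    intro h hh
    exact mul_nonneg (mdl.psplit_pos u h (Finset.mem_filter.mp hh).1).le (mdl.g_pos _ _).le
  have h2 : 0 ≤ ∑ k ∈ Finset.univ.filter (fun k => k ≠ mdl.cell u),
      mdl.p k * mdl.g k j * ρ k := by
    apply Finset.sum_nonneg
    intro k _
    exact mul_nonneg (mul_nonneg (mdl.p_pos k).le (mdl.g_pos _ _).le) (hρ k)
  have := mdl.σsq_pos
  linarith

theorem aux_sinr_pos (mdl : NomaModel n J C) {ρ : Fin n → ℝ} (hρ : ∀ i, 0 ≤ ρ i) {u : C} {j : J}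
    (hj : j ∈ mdl.members u) : 0 < mdl.sinr ρ u j :=
  div_pos (mul_pos (mdl.psplit_pos u j hj) (mdl.g_pos _ _)) (aux_den_pos mdl hρ u j)

theorem aux_cap_pos (mdl : NomaModel n J C) {ρ : Fin n → ℝ} (hρ : ∀ i, 0 ≤ ρ i) {u : C} {j : J}
    (hj : j ∈ mdl.members u) : 0 < mdl.cap ρ u j := by
  have := aux_sinr_pos mdl hρ hj
  exact mul_pos (mul_pos mdl.M_pos mdl.B_pos) (Real.log_pos (by linarith))

theorem aux_cap_anti (mdl : NomaModel n J C) {ρ ρ' : Fin n → ℝ} (hρ : ∀ i, 0 ≤ ρ i)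
    (hle : ∀ i, ρ i ≤ ρ' i) {u : C} {j : J}
    (hj : j ∈ mdl.members u) : mdl.cap ρ' u j ≤ mdl.cap ρ u j := by
  have hρ' : ∀ i, 0 ≤ ρ' i := fun i => (hρ i).trans (hle i)
  have h1 := aux_sinr_pos mdl hρ' hj
  have h2 : mdl.sinr ρ' u j ≤ mdl.sinr ρ u j := by
    unfold sinr
    apply div_le_div_of_nonneg_left
      (mul_pos (mdl.psplit_pos u j hj) (mdl.g_pos _ _)).le (aux_den_pos mdl hρ u j)
    have : ∑ k ∈ Finset.univ.filter (fun k => k ≠ mdl.cell u), mdl.p k * mdl.g k j * ρ k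
        ≤ ∑ k ∈ Finset.univ.filter (fun k => k ≠ mdl.cell u), mdl.p k * mdl.g k j * ρ' k := by
      apply Finset.sum_le_sum
      intro k _
      exact mul_le_mul_of_nonneg_left (hle k) (mul_nonneg (mdl.p_pos k).le (mdl.g_pos _ _).le)
    linarith
  unfold cap
  apply mul_le_mul_of_nonneg_left _ (mul_pos mdl.M_pos mdl.B_pos).le
  exact Real.log_le_log (by linarith) (by linarith)

/-- The allocations meeting the demands of cell `i`. -/
def AuxOK (mdl : NomaModel n J C) (ρ : Fin n → ℝ) (i : Fin n) (x : C → ℝ) : Prop :=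
  (∀ u, 0 ≤ x u) ∧
    (∀ j, mdl.serving j = i →
      mdl.d j ≤ ∑ u ∈ Finset.univ.filter (fun u => mdl.cell u = i ∧ j ∈ mdl.members u),
        mdl.cap ρ u j * x u)

/-- Total load of cell `i`. -/
noncomputable def auxLoad (mdl : NomaModel n J C) (i : Fin n) (x : C → ℝ) : ℝ :=
  ∑ u ∈ Finset.univ.filter (fun u => mdl.cell u = i), x u

theorem aux_exists_OK (mdl : NomaModel n J C) {ρ : Fin n → ℝ} (hρ : ∀ i, 0 ≤ ρ i) (i : Fin n) :
    ∃ x, AuxOK mdl ρ i x := by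
  choose v hv using mdl.covers
  have hterm : ∀ j, 0 ≤ mdl.d j / mdl.cap ρ (v j) j := fun j =>
    div_nonneg (mdl.d_nonneg j) (aux_cap_pos mdl hρ (hv j)).le
  have hK : 0 ≤ ∑ j, mdl.d j / mdl.cap ρ (v j) j := Finset.sum_nonneg fun j _ => hterm j
  refine ⟨fun _ => ∑ j, mdl.d j / mdl.cap ρ (v j) j, fun _ => hK, ?_⟩
  intro j hj
  have hc := aux_cap_pos mdl hρ (hv j)
  have h1 : mdl.d j / mdl.cap ρ (v j) j ≤ ∑ j, mdl.d j / mdl.cap ρ (v j) j :=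
    Finset.single_le_sum (f := fun j => mdl.d j / mdl.cap ρ (v j) j)
      (fun j _ => hterm j) (Finset.mem_univ j)
  have h2 : mdl.d j ≤ mdl.cap ρ (v j) j * ∑ j, mdl.d j / mdl.cap ρ (v j) j := by
    rw [div_le_iff₀ hc] at h1
    linarith
  refine h2.trans ?_
  apply Finset.single_le_sum
    (f := fun u => mdl.cap ρ u j * ∑ j, mdl.d j / mdl.cap ρ (v j) j)
  · intro u hu
    exact mul_nonneg (aux_cap_pos mdl hρ (Finset.mem_filter.mp hu).2.2).le hK
  · simp only [Finset.mem_filter, Finset.mem_univ, true_and]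
    exact ⟨(mdl.members_served _ _ (hv j)).symm.trans hj, hv j⟩

theorem aux_f_le (mdl : NomaModel n J C) {ρ : Fin n → ℝ} {i : Fin n} {x : C → ℝ}
    (hx : AuxOK mdl ρ i x) : mdl.f ρ i ≤ auxLoad mdl i x := by
  apply csInf_le
  · refine ⟨0, ?_⟩
    rintro s ⟨y, hy, -, rfl⟩
    exact Finset.sum_nonneg fun u _ => hy u
  · exact ⟨x, hx.1, hx.2, rfl⟩

theorem aux_f_nonneg (mdl : NomaModel n J C) (ρ : Fin n → ℝ) (i : Fin n) : 0 ≤ mdl.f ρ i := by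
  apply Real.sInf_nonneg
  rintro s ⟨y, hy, -, rfl⟩
  exact Finset.sum_nonneg fun u _ => hy u

theorem aux_f_mono (mdl : NomaModel n J C) {ρ ρ' : Fin n → ℝ} (hρ : ∀ i, 0 ≤ ρ i)
    (hle : ∀ i, ρ i ≤ ρ' i) (i : Fin n) : mdl.f ρ i ≤ mdl.f ρ' i := by
  have hρ' : ∀ i, 0 ≤ ρ' i := fun i => (hρ i).trans (hle i)
  apply le_csInf
  · obtain ⟨x, hx⟩ := aux_exists_OK mdl hρ' i
    exact ⟨_, x, hx.1, hx.2, rfl⟩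
  · rintro s ⟨y, hy, hy2, rfl⟩
    apply aux_f_le mdl
    refine ⟨hy, fun j hj => (hy2 j hj).trans ?_⟩
    apply Finset.sum_le_sum
    intro u hu
    exact mul_le_mul_of_nonneg_right
      (aux_cap_anti mdl hρ hle (Finset.mem_filter.mp hu).2.2) (hy u)

/-- The infimum defining `f` is attained. -/
theorem aux_attained (mdl : NomaModel n J C) {ρ : Fin n → ℝ} (hρ : ∀ i, 0 ≤ ρ i) (i : Fin n) :
    ∃ x, AuxOK mdl ρ i x ∧ mdl.f ρ i = auxLoad mdl i x := by
  obtain ⟨x0, hx0⟩ := aux_exists_OK mdl hρ i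
  set K : Set (C → ℝ) := {x | x ∈ Set.Icc 0 (fun _ => auxLoad mdl i x0) ∧ AuxOK mdl ρ i x} with hKdef
  have hcl : IsClosed {x | AuxOK mdl ρ i x} := by
    unfold AuxOK
    simp only [Set.ofPred_and, Set.ofPred_forall]
    apply IsClosed.inter
    · exact isClosed_iInter fun u => isClosed_le continuous_const (continuous_apply u)
    · refine isClosed_iInter fun j => isClosed_iInter fun _ => isClosed_le continuous_const ?_
      fun_prop
  have hK : IsCompact K := isCompact_Icc.inter_right hcl
  have htr : ∀ x, AuxOK mdl ρ i x → auxLoad mdl i x ≤ auxLoad mdl i x0 →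
      ∃ y ∈ K, auxLoad mdl i y = auxLoad mdl i x := by
    intro x hx hle
    have hl0 : 0 ≤ auxLoad mdl i x := Finset.sum_nonneg fun u _ => hx.1 u
    have hnn : ∀ u, 0 ≤ (if mdl.cell u = i then x u else 0) := by
      intro u
      split_ifs
      · exact hx.1 u
      · exact le_rfl
    refine ⟨fun u => if mdl.cell u = i then x u else 0, ⟨⟨hnn, ?_⟩, hnn, ?_⟩, ?_⟩
    · intro u
      show (if mdl.cell u = i then x u else 0) ≤ auxLoad mdl i x0
      split_ifs with h
      · refine le_trans ?_ hle
        exact Finset.single_le_sum (f := x) (fun u _ => hx.1 u) (by simpa using h)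
      · exact hl0.trans hle
    · intro j hj
      refine (hx.2 j hj).trans (le_of_eq ?_)
      apply Finset.sum_congr rfl
      intro u hu
      beta_reduce
      rw [if_pos (Finset.mem_filter.mp hu).2.1]
    · apply Finset.sum_congr rfl
      intro u hu
      beta_reduce
      rw [if_pos (Finset.mem_filter.mp hu).2]
  obtain ⟨y0, hy0, hy0e⟩ := htr x0 hx0 le_rfl
  have hcont : Continuous (auxLoad mdl i) := by
    unfold auxLoad
    fun_prop
  obtain ⟨z, hz, hmin⟩ := hK.exists_isMinOn ⟨y0, hy0⟩ hcont.continuousOn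
  refine ⟨z, hz.2, le_antisymm (aux_f_le mdl hz.2) ?_⟩
  apply le_csInf
  · exact ⟨_, z, hz.2.1, hz.2.2, rfl⟩
  · rintro s ⟨x, hx1, hx2, rfl⟩
    change auxLoad mdl i z ≤ auxLoad mdl i x
    by_cases h : auxLoad mdl i x ≤ auxLoad mdl i x0
    · obtain ⟨y, hy, hye⟩ := htr x ⟨hx1, hx2⟩ h
      rw [← hye]
      exact hmin hy
    · have h3 : auxLoad mdl i z ≤ auxLoad mdl i y0 := hmin hy0
      linarith

theorem aux_filter (mdl : NomaModel n J C) {i : Fin n} {j : J} (hj : mdl.serving j = i) :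
    Finset.univ.filter (fun u => mdl.cell u = i ∧ j ∈ mdl.members u)
      = Finset.univ.filter (fun u => j ∈ mdl.members u) := by
  ext u
  simp only [Finset.mem_filter, Finset.mem_univ, true_and, and_iff_right_iff_imp]
  intro h
  exact (mdl.members_served u j h).symm.trans hj

/-- Monotone maps with a post-fixed point have a fixed point below it. -/
theorem aux_fixed {n : ℕ} (F : (Fin n → ℝ) → Fin n → ℝ) (h0 : ∀ ρ i, 0 ≤ F ρ i)
    (hm : ∀ ρ ρ' : Fin n → ℝ, (∀ i, 0 ≤ ρ i) → (∀ i, ρ i ≤ ρ' i) → ∀ i, F ρ i ≤ F ρ' i)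
    (r : Fin n → ℝ) (hr0 : ∀ i, 0 ≤ r i) (hr : ∀ i, F r i ≤ r i) :
    ∃ s : Fin n → ℝ, (∀ i, 0 ≤ s i) ∧ F s = s ∧ ∀ i, s i ≤ r i := by
  set A : Set (Fin n → ℝ) := {q | (∀ i, 0 ≤ q i) ∧ ∀ i, F q i ≤ q i} with hA
  have hrA : r ∈ A := ⟨hr0, hr⟩
  let s : Fin n → ℝ := fun i => sInf ((fun q : Fin n → ℝ => q i) '' A)
  have hs0 : ∀ i, 0 ≤ s i := by
    intro i
    apply Real.sInf_nonneg
    rintro _ ⟨q, hq, rfl⟩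
    exact hq.1 i
  have hsle : ∀ q ∈ A, ∀ i, s i ≤ q i := by
    intro q hq i
    apply csInf_le
    · refine ⟨0, ?_⟩
      rintro _ ⟨q, hq, rfl⟩
      exact hq.1 i
    · exact ⟨q, hq, rfl⟩
  have h1 : ∀ i, F s i ≤ s i := by
    intro i
    apply le_csInf (Set.Nonempty.image _ ⟨r, hrA⟩)
    rintro _ ⟨q, hq, rfl⟩
    exact (hm s q hs0 (hsle q hq) i).trans (hq.2 i)
  have h2 : F s ∈ A := ⟨h0 s, hm (F s) s (h0 s) h1⟩
  exact ⟨s, hs0, funext fun i => le_antisymm (h1 i) (hsle _ h2 i), hsle r hrA⟩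

end helpers

end NomaModel

/-- Lemma 5: assume every cell serves at least one UE and all demands are strictly
positive. Then a feasible load vector exists if and only if `f` admits a fixed point
`ρ* ≥ 0` within the load limit `ρ̄`. -/
theorem NomaModel.feasible_iff_fixedPoint {n : ℕ} {J C : Type} [Fintype J] [Fintype C]
    (mdl : NomaModel n J C)
    (hserve : ∀ i : Fin n, ∃ j : J, mdl.serving j = i)
    (hd : ∀ j, 0 < mdl.d j) :
    (∃ ρ : Fin n → ℝ, mdl.Feasible ρ) ↔
      (∃ ρstar : Fin n → ℝ, (∀ i, 0 ≤ ρstar i) ∧ mdl.f ρstar = ρstar ∧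
        ∀ i, ρstar i ≤ mdl.ρbar) := by
  constructor
  · rintro ⟨ρ, hb, x, hx, hload, hdem⟩
    have hle : ∀ i, mdl.f ρ i ≤ ρ i := by
      intro i
      rw [hload i]
      refine aux_f_le mdl ⟨hx, fun j hj => ?_⟩
      rw [aux_filter mdl hj]
      exact hdem j
    obtain ⟨s, hs0, hfs, hsr⟩ := aux_fixed mdl.f (aux_f_nonneg mdl)
      (fun ρ ρ' h h' i => aux_f_mono mdl h h' i) ρ (fun i => (hb i).1) hle
    exact ⟨s, hs0, hfs, fun i => (hsr i).trans (hb i).2⟩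
  · rintro ⟨ρ, h0, hf, hbar⟩
    choose x hx hfx using fun i => aux_attained mdl h0 i
    refine ⟨ρ, fun i => ⟨h0 i, hbar i⟩, fun u => x (mdl.cell u) u, fun u => (hx _).1 u, ?_, ?_⟩
    · intro i
      rw [← congrFun hf i, hfx i]
      apply Finset.sum_congr rfl
      intro u hu
      beta_reduce
      rw [(Finset.mem_filter.mp hu).2]
    · intro j
      refine ((hx (mdl.serving j)).2 j rfl).trans (le_of_eq ?_)
      rw [aux_filter mdl rfl]
      apply Finset.sum_congr rfl
      intro u hu
      rw [mdl.members_served u j (Finset.mem_filter.mp hu).2]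
end
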